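/- Let ρ and σ be commuting states in 𝔖(ℋ) with S(ρ) < +∞, and set ε := ½‖ρ−σ‖₁ > 0, τ₊ := ε⁻¹[ρ−σ]₊ and τ₋ := ε⁻¹[ρ−σ]₋, where [ρ−σ]₊ and [ρ−σ]₋ are the positive and negative parts of the Hermitian trace-class operator ρ−σ. Then S(ρ) + ε·S(τ₋) ≤ S(σ) + ε·S(τ₊) + h(ε). -/

import Mathlib

open scoped ENNReal InnerProductSpace
open MeasureTheory

noncomputable section

namespace AFW

attribute [local instance] Classical.propDecidable

variable {𝓗 : Type*} [NormedAddCommGroup 𝓗] [InnerProductSpace ℂ 𝓗] [CompleteSpace 𝓗]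

/-- Trace-type functional: on positive operators it is the trace; on self-adjoint
trace-class operators it is the trace norm `‖·‖₁`. -/
def trNorm (T : 𝓗 →L[ℂ] 𝓗) : ℝ≥0∞ :=
  ⨆ (s : Set 𝓗) (_ : Orthonormal ℂ (Subtype.val : s → 𝓗)),
    ∑' x : s, (‖⟪(x : 𝓗), T x⟫_ℂ‖₊ : ℝ≥0∞)

/-- `ρ` is a quantum state: a positive (trace-class) operator with unit trace. -/
def IsState (ρ : 𝓗 →L[ℂ] 𝓗) : Prop := ρ.IsPositive ∧ trNorm ρ = 1

/-- `ρ ∧ εI` (spectral cut-off from above). -/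
def cut (ρ : 𝓗 →L[ℂ] 𝓗) (ε : ℝ) : 𝓗 →L[ℂ] 𝓗 := cfc (fun x : ℝ => min x ε) ρ

/-- `[ρ − εI]₊`. -/
def cutAbove (ρ : 𝓗 →L[ℂ] 𝓗) (ε : ℝ) : 𝓗 →L[ℂ] 𝓗 := cfc (fun x : ℝ => max (x - ε) 0) ρ

/-- positive part `[T]₊` of a self-adjoint operator. -/
def posP (T : 𝓗 →L[ℂ] 𝓗) : 𝓗 →L[ℂ] 𝓗 := cfc (fun x : ℝ => max x 0) T

/-- negative part `[T]₋` of a self-adjoint operator. -/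
def negP (T : 𝓗 →L[ℂ] 𝓗) : 𝓗 →L[ℂ] 𝓗 := cfc (fun x : ℝ => max (-x) 0) T

def sqrtOp (T : 𝓗 →L[ℂ] 𝓗) : 𝓗 →L[ℂ] 𝓗 := cfc Real.sqrt T

def eta (x : ℝ) : ℝ := -(x * Real.log x)

/-- The von Neumann entropy `S(ρ) = Tr η(ρ)`, with values in `[0,+∞]`. -/
def entropy (ρ : 𝓗 →L[ℂ] 𝓗) : ℝ≥0∞ := trNorm (cfc eta ρ)

/-- Homogeneous extension `S̃` of the von Neumann entropy to the positive cone. -/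
def entExt (ρ : 𝓗 →L[ℂ] 𝓗) : ℝ≥0∞ :=
  if ρ = 0 then 0 else trNorm ρ * entropy ((trNorm ρ).toReal⁻¹ • ρ)

def binEnt (p : ℝ) : ℝ := eta p + eta (1 - p)

def binEntUp (x : ℝ) : ℝ := if x ≤ 1 / 2 then binEnt x else Real.log 2

def etaUp (x : ℝ) : ℝ := if x ≤ (Real.exp 1)⁻¹ then eta x else (Real.exp 1)⁻¹

/-- nondecreasing modification `a↑` used for control functions. -/
def up (a : ℝ → ℝ) (x : ℝ) : ℝ := if x ≤ 1 / 2 then a x else a (1 / 2)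

/-- Control functions for LAA functions. -/
structure ControlPair (a b : ℝ → ℝ) : Prop where
  conta : ContinuousOn a (Set.Icc 0 1)
  contb : ContinuousOn b (Set.Icc 0 1)
  zeroa : a 0 = 0
  zerob : b 0 = 0
  cva : ConcaveOn ℝ (Set.Icc 0 (1 / 2)) a
  cvb : ConcaveOn ℝ (Set.Icc 0 (1 / 2)) b
  mona : MonotoneOn a (Set.Icc 0 (1 / 2))
  monb : MonotoneOn b (Set.Icc 0 (1 / 2))

/-- `f` is locally almost affine on `S0` with control functions `a`, `b`. -/
def IsLAA (S0 : Set (𝓗 →L[ℂ] 𝓗)) (f : (𝓗 →L[ℂ] 𝓗) → EReal) (a b : ℝ → ℝ) : Prop :=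
  ∀ ρ ∈ S0, ∀ σ ∈ S0, ∀ p : ℝ, 0 ≤ p → p ≤ 1 →
    ((p : EReal) * f ρ + ((1 - p : ℝ) : EReal) * f σ) - ((a p : ℝ) : EReal)
        ≤ f (p • ρ + (1 - p) • σ) ∧
      f (p • ρ + (1 - p) • σ)
        ≤ ((p : EReal) * f ρ + ((1 - p : ℝ) : EReal) * f σ) + ((b p : ℝ) : EReal)

/-- Homogeneous extension of `f` to the cone generated by its domain. -/
def homExt (f : (𝓗 →L[ℂ] 𝓗) → EReal) (T : 𝓗 →L[ℂ] 𝓗) : EReal :=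
  if T = 0 then 0 else (trNorm T : EReal) * f ((trNorm T).toReal⁻¹ • T)

/-- The barycenter `Ω(μ)` of the family `w` with respect to `μ`. -/
def Omega {X : Type*} [MeasurableSpace X] (w : X → 𝓗 →L[ℂ] 𝓗) (μ : Measure X) :
    𝓗 →L[ℂ] 𝓗 := ∫ x, w x ∂μ

/-- The quasi-classical set of states generated by `(X, 𝔉, w)`. -/
def QSet {X : Type*} [MeasurableSpace X] (w : X → 𝓗 →L[ℂ] 𝓗) : Set (𝓗 →L[ℂ] 𝓗) :=
  {ρ | ∃ μ : Measure X, IsProbabilityMeasure μ ∧ ρ = Omega w μ}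

/-- Total variation distance between measures. -/
def TV {X : Type*} [MeasurableSpace X] (μ ν : Measure X) : ℝ≥0∞ :=
  ⨆ (A : Set X) (_ : MeasurableSet A), (μ A - ν A) ⊔ (ν A - μ A)

/-- `Tr H ρ` for a positive operator `H = Σ h_k |τ_k⟩⟨τ_k|` given by discrete spectral data. -/
def energy (h : ℕ → ℝ) (τ : ℕ → 𝓗) (ρ : 𝓗 →L[ℂ] 𝓗) : ℝ≥0∞ :=
  if LinearMap.range (ρ : 𝓗 →ₗ[ℂ] 𝓗) ≤ (Submodule.span ℂ (Set.range τ)).topologicalClosure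
  then ∑' k, ENNReal.ofReal (h k * (⟪τ k, ρ (τ k)⟫_ℂ).re)
  else ⊤

/-- A positive operator with discrete spectral representation `Σ h_k |τ_k⟩⟨τ_k|`
(nondecreasing nonnegative eigenvalue sequence, orthonormal eigenvectors). -/
structure DiscreteOp (h : ℕ → ℝ) (τ : ℕ → 𝓗) : Prop where
  ortho : Orthonormal ℂ τ
  nonneg : ∀ k, 0 ≤ h k
  mono : Monotone h

/-- The Gibbs condition `Tr e^{−βH} < ∞` for all `β > 0`. -/
def GibbsCondition (h : ℕ → ℝ) : Prop := ∀ β : ℝ, 0 < β → Summable fun k => Real.exp (-β * h k)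

/-- `F_H(E) = sup { S(ρ) : Tr Hρ ≤ E }`. -/
def FH (h : ℕ → ℝ) (τ : ℕ → 𝓗) (E : ℝ≥0∞) : ℝ≥0∞ :=
  ⨆ (ϑ : 𝓗 →L[ℂ] 𝓗) (_ : IsState ϑ) (_ : energy h τ ϑ ≤ E), entropy ϑ

/-- `Tr(ρ M)` for positive `ρ`, `M`, computed as `Tr(√ρ M √ρ)`. -/
def trPair (ρ M : 𝓗 →L[ℂ] 𝓗) : ℝ≥0∞ := trNorm (sqrtOp ρ * M * sqrtOp ρ)

/-- classical relative entropy of two finite tuples. -/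
def klFin {n : ℕ} (p q : Fin n → ℝ) : ℝ≥0∞ :=
  if ∀ i, q i = 0 → p i = 0 then
    ENNReal.ofReal (∑ i, if p i = 0 then 0 else p i * Real.log (p i / q i))
  else ⊤

/-- The quantum relative entropy `D(ρ‖σ)`, realized as the supremum of classical
relative entropies of outcome distributions over all finite quantum measurements. -/
def relEnt (ρ σ : 𝓗 →L[ℂ] 𝓗) : ℝ≥0∞ :=
  ⨆ (n : ℕ) (M : Fin n → 𝓗 →L[ℂ] 𝓗) (_ : ∀ i, (M i).IsPositive) (_ : ∑ i, M i = 1),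
    klFin (fun i => (trPair ρ (M i)).toReal) (fun i => (trPair σ (M i)).toReal)

/-- rank of an operator (junk value `0` if infinite). -/
def opRank (T : 𝓗 →L[ℂ] 𝓗) : ℕ := Module.finrank ℂ (LinearMap.range (T : 𝓗 →ₗ[ℂ] 𝓗))

/-- a positive trace-preserving linear map (such as a partial trace). -/
def IsMarginal {𝓚 : Type*} [NormedAddCommGroup 𝓚] [InnerProductSpace ℂ 𝓚] [CompleteSpace 𝓚]
    (Λ : (𝓗 →L[ℂ] 𝓗) →ₗ[ℂ] (𝓚 →L[ℂ] 𝓚)) : Prop :=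
  (∀ T : 𝓗 →L[ℂ] 𝓗, T.IsPositive → (Λ T).IsPositive) ∧
  (∀ T : 𝓗 →L[ℂ] 𝓗, T.IsPositive → trNorm (Λ T) = trNorm T)

end AFW

namespace AFW


section TraceNorm

variable {𝓗 : Type*} [NormedAddCommGroup 𝓗] [InnerProductSpace ℂ 𝓗]

lemma IsPositive.ennnorm_inner_eq {T : 𝓗 →L[ℂ] 𝓗} (hT : T.IsPositive) (x : 𝓗) :
    (‖⟪x, T x⟫_ℂ‖₊ : ℝ≥0∞) = ENNReal.ofReal (⟪x, T x⟫_ℂ).re := by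
  have h := hT.inner_nonneg_right x
  have hre : (⟪x, T x⟫_ℂ).re = ‖⟪x, T x⟫_ℂ‖ := by
    have := Complex.norm_of_nonneg' h
    rw [← this, Complex.ofReal_re, this]
  rw [hre, ofReal_norm]
  rfl

/-- The squared norm as a sum over a Hilbert basis, in `ℝ≥0∞`. -/
lemma tsum_ofReal_sq_norm_inner {ι : Type*} (b : HilbertBasis ι ℂ 𝓗) (x : 𝓗) :
    ∑' i, ENNReal.ofReal (‖⟪b i, x⟫_ℂ‖ ^ 2) = ENNReal.ofReal (‖x‖ ^ 2) := by
  have h := b.hasSum_inner_mul_inner x x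
  have h2 : HasSum (fun i => ‖⟪b i, x⟫_ℂ‖ ^ 2) (‖x‖ ^ 2) := by
    have h3 := Complex.hasSum_re h
    convert h3 using 1
    · ext i
      rw [← inner_conj_symm x (b i), mul_comm, Complex.mul_conj, Complex.normSq_eq_norm_sq,
        Complex.ofReal_re]
    · rw [inner_self_eq_norm_sq_to_K]
      norm_cast
  rw [← h2.tsum_eq, ENNReal.ofReal_tsum_of_nonneg (fun i => by positivity) h2.summable]

lemma tsum_ofReal_sq_norm_inner_le {ι : Type*} {v : ι → 𝓗} (hv : Orthonormal ℂ v) (x : 𝓗) :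
    ∑' i, ENNReal.ofReal (‖⟪v i, x⟫_ℂ‖ ^ 2) ≤ ENNReal.ofReal (‖x‖ ^ 2) := by
  rw [← ENNReal.ofReal_tsum_of_nonneg (fun i => by positivity) (hv.inner_products_summable x)]
  exact ENNReal.ofReal_le_ofReal (hv.tsum_inner_products_le x)

lemma tsum_inner_le_trNorm (T : 𝓗 →L[ℂ] 𝓗) {w : Set 𝓗}
    (hw : Orthonormal ℂ (Subtype.val : w → 𝓗)) :
    ∑' x : w, (‖⟪(x : 𝓗), T x⟫_ℂ‖₊ : ℝ≥0∞) ≤ trNorm T :=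
  le_iSup₂_of_le w hw le_rfl

lemma trNorm_smul {c : ℝ} (hc : 0 ≤ c) (T : 𝓗 →L[ℂ] 𝓗) :
    trNorm (c • T) = ENNReal.ofReal c * trNorm T := by
  unfold trNorm
  simp only [ENNReal.mul_iSup, ← ENNReal.tsum_mul_left]
  refine iSup_congr fun s => iSup_congr fun hs => tsum_congr fun x => ?_
  rw [smul_apply, inner_smul_right_eq_smul, nnnorm_smul, ENNReal.coe_mul,
    ENNReal.ofReal_eq_coe_nnreal hc, Real.nnnorm_of_nonneg hc]

lemma trNorm_sub_le (S T : 𝓗 →L[ℂ] 𝓗) : trNorm (S - T) ≤ trNorm S + trNorm T := by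
  refine iSup₂_le fun s hs => ?_
  refine le_trans ?_ (add_le_add (tsum_inner_le_trNorm S hs) (tsum_inner_le_trNorm T hs))
  rw [← ENNReal.tsum_add]
  refine ENNReal.tsum_le_tsum fun x => ?_
  rw [sub_apply, inner_sub_right]
  exact_mod_cast nnnorm_sub_le _ _

lemma norm_inner_le_trNorm (T : 𝓗 →L[ℂ] 𝓗) {x : 𝓗} (hx : ‖x‖ = 1) :
    (‖⟪x, T x⟫_ℂ‖₊ : ℝ≥0∞) ≤ trNorm T := by
  have hs : Orthonormal ℂ (Subtype.val : ({x} : Set 𝓗) → 𝓗) :=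
    ⟨fun i => by rw [i.2, hx], fun i j hij => (hij (Subsingleton.elim i j)).elim⟩
  refine le_trans ?_ (tsum_inner_le_trNorm T hs)
  simp

lemma norm_inner_le_of_trNorm_le {T : 𝓗 →L[ℂ] 𝓗} {c : ℝ} (hc : 0 ≤ c)
    (h : trNorm T ≤ ENNReal.ofReal c) (x : 𝓗) : ‖⟪x, T x⟫_ℂ‖ ≤ c * ‖x‖ ^ 2 := by
  rcases eq_or_ne x 0 with rfl | hx
  · simp
  have hx' : 0 < ‖x‖ := norm_pos_iff.2 hx
  obtain ⟨u, hu, hxu⟩ : ∃ u : 𝓗, ‖u‖ = 1 ∧ x = (‖x‖ : ℂ) • u := by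
    refine ⟨(‖x‖ : ℂ)⁻¹ • x, norm_smul_inv_norm hx, ?_⟩
    rw [smul_inv_smul₀]
    exact_mod_cast hx'.ne'
  have h1 : ‖⟪u, T u⟫_ℂ‖ ≤ c := by
    have h2 := (norm_inner_le_trNorm T hu).trans h
    have h3 : ENNReal.ofReal ‖⟪u, T u⟫_ℂ‖ ≤ ENNReal.ofReal c := by
      rw [ofReal_norm]
      exact h2
    exact (ENNReal.ofReal_le_ofReal_iff hc).1 h3
  have h4 : ‖⟪x, T x⟫_ℂ‖ = ‖x‖ ^ 2 * ‖⟪u, T u⟫_ℂ‖ := by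
    conv_lhs => rw [hxu]
    rw [map_smul, inner_smul_left, inner_smul_right, norm_mul, norm_mul]
    simp
    ring
  rw [h4, mul_comm]
  gcongr

variable [CompleteSpace 𝓗]

/-- For a positive operator the diagonal sum over any orthonormal family is dominated by the
one over any Hilbert basis. -/
lemma IsPositive.tsum_inner_le {T : 𝓗 →L[ℂ] 𝓗} (hT : T.IsPositive) {ι κ : Type*}
    (b : HilbertBasis ι ℂ 𝓗) {v : κ → 𝓗} (hv : Orthonormal ℂ v) :
    ∑' k, (‖⟪v k, T (v k)⟫_ℂ‖₊ : ℝ≥0∞) ≤ ∑' i, (‖⟪b i, T (b i)⟫_ℂ‖₊ : ℝ≥0∞) := by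
  have hT' : 0 ≤ T := (ContinuousLinearMap.nonneg_iff_isPositive T).2 hT
  set R := CFC.sqrt T with hR
  have hRR : R * R = T := CFC.sqrt_mul_sqrt_self T hT'
  have hRpos : R.IsPositive :=
    (ContinuousLinearMap.nonneg_iff_isPositive R).1 (CFC.sqrt_nonneg T)
  have hsymm : ∀ x y : 𝓗, ⟪R x, y⟫_ℂ = ⟪x, R y⟫_ℂ := fun x y => hRpos.isSymmetric x y
  have key : ∀ x : 𝓗, (‖⟪x, T x⟫_ℂ‖₊ : ℝ≥0∞) = ENNReal.ofReal (‖R x‖ ^ 2) := by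
    intro x
    rw [IsPositive.ennnorm_inner_eq hT, ← hRR, mul_apply_eq_comp, ← hsymm]
    congr 1
    exact inner_self_eq_norm_sq (𝕜 := ℂ) (R x)
  simp only [key]
  calc ∑' k, ENNReal.ofReal (‖R (v k)‖ ^ 2)
      = ∑' k, ∑' i, ENNReal.ofReal (‖⟪b i, R (v k)⟫_ℂ‖ ^ 2) := by
        simp only [tsum_ofReal_sq_norm_inner]
    _ = ∑' i, ∑' k, ENNReal.ofReal (‖⟪v k, R (b i)⟫_ℂ‖ ^ 2) := by
        rw [ENNReal.tsum_comm]
        simp only [← hsymm, norm_inner_symm]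
    _ ≤ ∑' i, ENNReal.ofReal (‖R (b i)‖ ^ 2) :=
        ENNReal.tsum_le_tsum fun i => tsum_ofReal_sq_norm_inner_le hv _

/-- The trace norm of a positive operator is its diagonal sum over any Hilbert basis. -/
lemma IsPositive.trNorm_eq_tsum {T : 𝓗 →L[ℂ] 𝓗} (hT : T.IsPositive) {w : Set 𝓗}
    (b : HilbertBasis w ℂ 𝓗) (hb : ⇑b = ((↑) : w → 𝓗)) :
    trNorm T = ∑' x : w, ENNReal.ofReal (⟪(x : 𝓗), T x⟫_ℂ).re := by
  simp only [← IsPositive.ennnorm_inner_eq hT]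
  refine le_antisymm (iSup₂_le fun s hs => ?_) (tsum_inner_le_trNorm T (hb ▸ b.orthonormal))
  simpa [hb] using IsPositive.tsum_inner_le hT b hs

lemma IsPositive.trNorm_add {S T : 𝓗 →L[ℂ] 𝓗} (hS : S.IsPositive) (hT : T.IsPositive) :
    trNorm (S + T) = trNorm S + trNorm T := by
  obtain ⟨w, b, hb⟩ := exists_hilbertBasis ℂ 𝓗
  rw [IsPositive.trNorm_eq_tsum hS b hb, IsPositive.trNorm_eq_tsum hT b hb,
    IsPositive.trNorm_eq_tsum (hS.add hT) b hb, ← ENNReal.tsum_add]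
  refine tsum_congr fun x => ?_
  have h := ENNReal.ofReal_add (hS.re_inner_nonneg_right (x : 𝓗))
    (hT.re_inner_nonneg_right (x : 𝓗))
  simpa [inner_add_right] using h

/-- If `A` and `B` are positive with `A B = 0`, then `‖A‖₁ + ‖B‖₁ ≤ ‖A - B‖₁`. -/
lemma IsPositive.trNorm_add_le_trNorm_sub {A B : 𝓗 →L[ℂ] 𝓗} (hA : A.IsPositive)
    (hB : B.IsPositive) (hAB : A * B = 0) : trNorm A + trNorm B ≤ trNorm (A - B) := by
  set K : Submodule ℂ 𝓗 := LinearMap.ker (A : 𝓗 →ₗ[ℂ] 𝓗) with hK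
  have hKc : IsClosed (K : Set 𝓗) := A.isClosed_ker
  have : CompleteSpace K := hKc.completeSpace_coe
  obtain ⟨u, c, hc⟩ := exists_hilbertBasis ℂ K
  have hs : Orthonormal ℂ (Subtype.val : (Subtype.val '' u : Set 𝓗) → 𝓗) := by
    have h1 : Orthonormal ℂ (fun x : u => ((x : K) : 𝓗)) := by
      have := c.orthonormal.comp_linearIsometry K.subtypeₗᵢ
      rw [hc] at this
      exact this
    have h2 := h1.toSubtypeRange
    have h3 : Set.range (fun x : u => ((x : K) : 𝓗)) = Subtype.val '' u := by
      rw [Set.image_eq_range]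
    rwa [h3] at h2
  obtain ⟨w, b, hsw, hb⟩ := hs.exists_hilbertBasis_extension
  have hw : Orthonormal ℂ (Subtype.val : w → 𝓗) := hb ▸ b.orthonormal
  have hmem : ∀ x : w, A x = 0 ∨ B x = 0 := by
    rintro ⟨x, hx⟩
    by_cases hxs : x ∈ (Subtype.val '' u : Set 𝓗)
    · obtain ⟨y, -, rfl⟩ := hxs
      exact Or.inl y.2
    · right
      have horth : ∀ y ∈ K, ⟪x, y⟫_ℂ = 0 := by
        intro y hy
        have hcl : IsClosed {z : K | ⟪x, (z : 𝓗)⟫_ℂ = 0} :=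
          isClosed_eq (by fun_prop) continuous_const
        have hsub : (Submodule.span ℂ (Set.range c) : Set K) ⊆ {z : K | ⟪x, (z : 𝓗)⟫_ℂ = 0} := by
          intro z hz
          induction hz using Submodule.span_induction with
          | mem z hz =>
            obtain ⟨i, rfl⟩ := hz
            have hi : ((i : K) : 𝓗) ∈ (Subtype.val '' u : Set 𝓗) := ⟨i, i.2, rfl⟩
            have := hw.2 (i := ⟨x, hx⟩) (j := ⟨_, hsw hi⟩)
              (fun h => hxs (by rw [Subtype.mk.injEq] at h; rw [h]; exact hi))
            simpa [hc] using this
          | zero => simp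
          | add z₁ z₂ _ _ h₁ h₂ =>
            simp only [Set.mem_ofPred_eq] at h₁ h₂ ⊢
            simp [h₁, h₂]
          | smul r z _ h =>
            simp only [Set.mem_ofPred_eq] at h ⊢
            simp [h]
        have hmem : (⟨y, hy⟩ : K) ∈ closure (Submodule.span ℂ (Set.range c) : Set K) := by
          have := c.dense_span
          rw [← Submodule.topologicalClosure_coe, this]
          trivial
        exact closure_minimal hsub hcl hmem
      have hABx : ∀ y, A (B y) = 0 := fun y => by
        rw [← mul_apply_eq_comp, hAB]; rfl
      have h0 : ⟪B x, B x⟫_ℂ = 0 := by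
        have h := hB.isSymmetric x (B x)
        exact h.trans (horth _ (hABx _))
      exact inner_self_eq_zero.1 h0
  rw [← IsPositive.trNorm_add hA hB, IsPositive.trNorm_eq_tsum (hA.add hB) b hb]
  refine le_trans (ENNReal.tsum_le_tsum fun x => ?_) (tsum_inner_le_trNorm (A - B) hw)
  rw [← IsPositive.ennnorm_inner_eq (hA.add hB)]
  rcases hmem x with h | h <;> simp [h]

end TraceNorm

section Scalar

lemma continuous_eta : Continuous eta := Real.continuous_mul_log.neg

lemma eta_nonneg {x : ℝ} (h0 : 0 ≤ x) (h1 : x ≤ 1) : 0 ≤ eta x :=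
  neg_nonneg.2 (Real.mul_log_nonpos h0 h1)

lemma eta_zero : eta 0 = 0 := by simp [eta]

lemma eta_add_le {x y : ℝ} (hx : 0 ≤ x) (hy : 0 ≤ y) : eta (x + y) ≤ eta x + eta y := by
  have key : ∀ u v : ℝ, 0 ≤ u → 0 ≤ v → u * Real.log u ≤ u * Real.log (u + v) := by
    intro u v hu hv
    rcases hu.eq_or_lt with rfl | hu
    · simp
    · exact mul_le_mul_of_nonneg_left (Real.log_le_log hu (by linarith)) hu.le
  have h1 := key x y hx hy
  have h2 := key y x hy hx
  rw [add_comm y x] at h2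
  unfold eta
  linarith

lemma mul_eta_inv_mul {ε : ℝ} (hε : 0 < ε) (x : ℝ) :
    ε * eta (ε⁻¹ * x) = eta x + x * Real.log ε := by
  rcases eq_or_ne x 0 with rfl | hx
  · simp [eta]
  · rw [eta, eta, Real.log_mul (inv_ne_zero hε.ne') hx, Real.log_inv]
    field_simp
    ring

/-- The pointwise inequality whose trace is the entropy bound. -/
lemma eta_add_mul_eta_le {p q ε : ℝ} (hp : 0 ≤ p) (hq : 0 ≤ q) (hε : 0 < ε) (hε1 : ε ≤ 1)
    (hm : min p q ≤ 1 - ε) :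
    eta p + ε * eta (ε⁻¹ * max (-(p - q)) 0) ≤
      eta q + ε * eta (ε⁻¹ * max (p - q) 0) + (-Real.log ε) * max (p - q) 0
        + (-Real.log (1 - ε)) * min p q := by
  have hlog : Real.log (1 - ε) ≤ 0 := Real.log_nonpos (by linarith) (by linarith)
  rw [mul_eta_inv_mul hε, mul_eta_inv_mul hε]
  rcases le_total q p with h | h
  · rw [max_eq_right (by linarith : -(p - q) ≤ 0), max_eq_left (by linarith : 0 ≤ p - q),
      min_eq_right h]
    have h1 := eta_add_le hq (sub_nonneg.2 h)
    rw [add_sub_cancel] at h1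
    rw [eta_zero]
    nlinarith [mul_nonneg (neg_nonneg.2 hlog) hq]
  · obtain ⟨b, rfl⟩ : ∃ b, q = p + b := ⟨q - p, by ring⟩
    have hb : 0 ≤ b := by linarith
    rw [min_eq_left h] at hm ⊢
    rw [max_eq_left (by linarith : 0 ≤ -(p - (p + b))),
      max_eq_right (by linarith : p - (p + b) ≤ 0), eta_zero,
      show -(p - (p + b)) = b by ring]
    have h1 : b * (Real.log (p + b) + Real.log ε - Real.log b) ≤ (p + b) * ε - b := by
      rcases hb.eq_or_lt with rfl | hb
      · nlinarith
      · have h2 := Real.log_le_sub_one_of_pos (x := (p + b) * ε / b) (by positivity)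
        rw [Real.log_div (by positivity) hb.ne', Real.log_mul (by positivity) hε.ne'] at h2
        have h3 := mul_le_mul_of_nonneg_left h2 hb.le
        rwa [mul_sub _ (_ / _), mul_div_cancel₀ _ hb.ne', mul_one] at h3
    have h2 : p * (Real.log (p + b) + Real.log (1 - ε) - Real.log p) ≤ (p + b) * (1 - ε) - p := by
      rcases hp.eq_or_lt with rfl | hp
      · nlinarith
      · have he : 0 < 1 - ε := hp.trans_le hm
        have h2 := Real.log_le_sub_one_of_pos (x := (p + b) * (1 - ε) / p) (by positivity)
        rw [Real.log_div (by positivity) hp.ne', Real.log_mul (by positivity) he.ne'] at h2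
        have h3 := mul_le_mul_of_nonneg_left h2 hp.le
        rwa [mul_sub _ (_ / _), mul_div_cancel₀ _ hp.ne', mul_one] at h3
    unfold eta
    linarith

end Scalar

section JointCalculus

variable {𝓗 : Type*} [NormedAddCommGroup 𝓗] [InnerProductSpace ℂ 𝓗] [CompleteSpace 𝓗]

/-- The continuous functional calculus of an operator, restricted to real-valued functions
on the complex plane. -/
def realCfc (N : 𝓗 →L[ℂ] 𝓗) (f : ℂ → ℝ) : 𝓗 →L[ℂ] 𝓗 := cfc (fun z : ℂ => (f z : ℂ)) N

variable {N : 𝓗 →L[ℂ] 𝓗} {f g : ℂ → ℝ}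

open scoped ComplexOrder in
lemma isPositive_realCfc (hf : ∀ z ∈ spectrum ℂ N, 0 ≤ f z) : (realCfc N f).IsPositive :=
  (ContinuousLinearMap.nonneg_iff_isPositive _).1
    (cfc_nonneg fun z hz => Complex.zero_le_real.2 (hf z hz))

open scoped ComplexOrder in
lemma nonneg_of_isPositive_realCfc (hN : IsStarNormal N) (hf : Continuous f)
    (h : (realCfc N f).IsPositive) : ∀ z ∈ spectrum ℂ N, 0 ≤ f z := by
  have h' := (ContinuousLinearMap.nonneg_iff_isPositive _).2 h
  exact fun z hz => Complex.zero_le_real.1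
    ((cfc_nonneg_iff (fun z : ℂ => (f z : ℂ)) N (by fun_prop) hN).1 h' z hz)

lemma realCfc_add (hf : Continuous f) (hg : Continuous g) :
    realCfc N (fun z => f z + g z) = realCfc N f + realCfc N g := by
  unfold realCfc
  rw [← cfc_add N _ _ (by fun_prop) (by fun_prop)]
  simp

lemma realCfc_sub (hf : Continuous f) (hg : Continuous g) :
    realCfc N (fun z => f z - g z) = realCfc N f - realCfc N g := by
  unfold realCfc
  rw [← cfc_sub _ _ N (by fun_prop) (by fun_prop)]
  simp

lemma realCfc_mul (hf : Continuous f) (hg : Continuous g) :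
    realCfc N (fun z => f z * g z) = realCfc N f * realCfc N g := by
  unfold realCfc
  rw [← cfc_mul _ _ N (by fun_prop) (by fun_prop)]
  simp

lemma realCfc_const_mul (hf : Continuous f) (c : ℝ) :
    realCfc N (fun z => c * f z) = c • realCfc N f := by
  unfold realCfc
  rw [← cfc_smul c _ N (by fun_prop)]
  simp

lemma cfc_realCfc (hN : IsStarNormal N) (hf : Continuous f) {φ : ℝ → ℝ} (hφ : Continuous φ) :
    cfc φ (realCfc N f) = realCfc N (fun z => φ (f z)) := by
  have hsa : IsSelfAdjoint (realCfc N f) := by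
    unfold realCfc
    rw [isSelfAdjoint_iff, ← cfc_star]
    simp
  rw [cfc_real_eq_complex φ hsa]
  unfold realCfc
  rw [← cfc_comp' (fun z : ℂ => (φ z.re : ℂ)) (fun z : ℂ => (f z : ℂ)) N
    (by fun_prop) (by fun_prop) hN]
  simp

lemma isPositive_smul_one_sub {T : 𝓗 →L[ℂ] 𝓗} (hT : T.IsPositive) {c : ℝ} (hc : 0 ≤ c)
    (h : trNorm T ≤ ENNReal.ofReal c) : (c • (1 : 𝓗 →L[ℂ] 𝓗) - T).IsPositive := by
  have hsa : IsSelfAdjoint (c • (1 : 𝓗 →L[ℂ] 𝓗) - T) :=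
    ((IsSelfAdjoint.all c).smul (IsSelfAdjoint.one _)).sub hT.isSelfAdjoint
  refine ContinuousLinearMap.isPositive_def'.2 ⟨hsa, fun x => ?_⟩
  have h1 := (RCLike.re_le_norm ⟪x, T x⟫_ℂ).trans (norm_inner_le_of_trNorm_le hc h x)
  rw [← inner_conj_symm, RCLike.conj_re] at h1
  have h2 : RCLike.re ⟪(c • (1 : 𝓗 →L[ℂ] 𝓗)) x, x⟫_ℂ = c * ‖x‖ ^ 2 := by
    rw [smul_apply, one_apply_eq_self, ← Complex.coe_smul, inner_smul_left,
      inner_self_eq_norm_sq_to_K, Complex.conj_ofReal]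
    refine (Complex.re_ofReal_mul c _).trans ?_
    norm_cast
  rw [ContinuousLinearMap.reApplyInnerSelf_apply, sub_apply, inner_sub_left, map_sub, h2]
  linarith

lemma le_of_trNorm_realCfc_le (hN : IsStarNormal N) (hf : Continuous f)
    (hf0 : ∀ z ∈ spectrum ℂ N, 0 ≤ f z) {c : ℝ} (hc : 0 ≤ c)
    (h : trNorm (realCfc N f) ≤ ENNReal.ofReal c) : ∀ z ∈ spectrum ℂ N, f z ≤ c := by
  have h1 := isPositive_smul_one_sub (isPositive_realCfc hf0) hc h
  have h2 : c • (1 : 𝓗 →L[ℂ] 𝓗) - realCfc N f = realCfc N (fun z => c - f z) := by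
    rw [realCfc_sub continuous_const hf]
    congr 1
    unfold realCfc
    rw [cfc_const _ N hN, Algebra.algebraMap_eq_smul_one, Complex.coe_smul]
  rw [h2] at h1
  exact fun z hz => sub_nonneg.1
    (nonneg_of_isPositive_realCfc hN (by fun_prop) h1 z hz)

lemma trNorm_realCfc_add (hf : Continuous f) (hg : Continuous g)
    (hf0 : ∀ z ∈ spectrum ℂ N, 0 ≤ f z) (hg0 : ∀ z ∈ spectrum ℂ N, 0 ≤ g z) :
    trNorm (realCfc N (fun z => f z + g z)) = trNorm (realCfc N f) + trNorm (realCfc N g) := by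
  rw [realCfc_add hf hg,
    IsPositive.trNorm_add (isPositive_realCfc hf0) (isPositive_realCfc hg0)]

lemma trNorm_realCfc_const_mul (hf : Continuous f) {c : ℝ} (hc : 0 ≤ c) :
    trNorm (realCfc N (fun z => c * f z)) = ENNReal.ofReal c * trNorm (realCfc N f) := by
  rw [realCfc_const_mul hf, trNorm_smul hc]

lemma trNorm_realCfc_mono (hf : Continuous f) (hg : Continuous g)
    (hf0 : ∀ z ∈ spectrum ℂ N, 0 ≤ f z) (hfg : ∀ z ∈ spectrum ℂ N, f z ≤ g z) :
    trNorm (realCfc N f) ≤ trNorm (realCfc N g) := by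
  have h := trNorm_realCfc_add hf (hg.sub hf) hf0 fun z hz => sub_nonneg.2 (hfg z hz)
  simp only [Pi.sub_apply, add_sub_cancel] at h
  rw [h]
  exact le_self_add

lemma realCfc_zero : realCfc N (fun _ => 0) = 0 := by
  simp [realCfc]

/-- Commuting self-adjoint operators are the real and imaginary parts of a normal operator. -/
lemma isStarNormal_add_I_smul {ρ σ : 𝓗 →L[ℂ] 𝓗} (hρ : star ρ = ρ) (hσ : star σ = σ)
    (hcomm : ρ * σ = σ * ρ) :
    IsStarNormal (ρ + Complex.I • σ) ∧
      realCfc (ρ + Complex.I • σ) (fun z => z.re) = ρ ∧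
      realCfc (ρ + Complex.I • σ) (fun z => z.im) = σ := by
  have hstar : star (ρ + Complex.I • σ) = ρ - Complex.I • σ := by
    rw [star_add, star_smul, hρ, hσ]
    simp [sub_eq_add_neg]
  have hN : IsStarNormal (ρ + Complex.I • σ) := by
    rw [isStarNormal_iff, hstar, commute_iff_eq]
    simp only [mul_add, add_mul, mul_sub, sub_mul, smul_mul_assoc, mul_smul_comm, hcomm, smul_add, smul_sub]
    abel
  refine ⟨hN, ?_, ?_⟩
  · refine (cfc_re_id _ hN).trans ?_
    rw [realPart_apply_coe, hstar, add_add_sub_cancel, ← two_smul ℝ ρ, smul_smul]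
    norm_num
  · refine (cfc_im_id _ hN).trans ?_
    rw [imaginaryPart_apply_coe, hstar, add_sub_sub_cancel, ← two_smul ℝ (Complex.I • σ),
      smul_smul, smul_comm, ← smul_assoc (-Complex.I)]
    simp

end JointCalculus

/-- inequality (S-1): refined AFW inequality for the von Neumann entropy
of commuting states. -/
theorem stmt12
    {𝓗 : Type*} [NormedAddCommGroup 𝓗] [InnerProductSpace ℂ 𝓗] [CompleteSpace 𝓗]
    (ρ σ : 𝓗 →L[ℂ] 𝓗) (hρ : IsState ρ) (hσ : IsState σ) (hcomm : ρ * σ = σ * ρ)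
    (hfin : entropy ρ ≠ ⊤)
    (ε : ℝ) (hε : 0 < ε) (hdist : trNorm (ρ - σ) = ENNReal.ofReal (2 * ε)) :
    entropy ρ + ENNReal.ofReal ε * entropy (ε⁻¹ • negP (ρ - σ))
      ≤ entropy σ + ENNReal.ofReal ε * entropy (ε⁻¹ • posP (ρ - σ))
        + ENNReal.ofReal (binEnt ε) := by
  set N : 𝓗 →L[ℂ] 𝓗 := ρ + Complex.I • σ with hNdef
  have hρsa : star ρ = ρ := hρ.1.isSelfAdjoint
  have hσsa : star σ = σ := hσ.1.isSelfAdjoint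
  obtain ⟨hN, hre, him⟩ := isStarNormal_add_I_smul hρsa hσsa hcomm
  rw [← hNdef] at hN hre him
  have cp : Continuous fun z : ℂ => z.re := Complex.continuous_re
  have cq : Continuous fun z : ℂ => z.im := Complex.continuous_im
  have ca : Continuous fun z : ℂ => max (z.re - z.im) 0 := by fun_prop
  have cb : Continuous fun z : ℂ => max (-(z.re - z.im)) 0 := by fun_prop
  have cm : Continuous fun z : ℂ => min z.re z.im := by fun_prop
  have hp0 : ∀ z ∈ spectrum ℂ N, 0 ≤ z.re :=
    nonneg_of_isPositive_realCfc hN cp (hre ▸ hρ.1)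
  have hq0 : ∀ z ∈ spectrum ℂ N, 0 ≤ z.im :=
    nonneg_of_isPositive_realCfc hN cq (him ▸ hσ.1)
  have ha0 : ∀ z ∈ spectrum ℂ N, 0 ≤ max (z.re - z.im) 0 := fun _ _ => le_max_right _ _
  have hb0 : ∀ z ∈ spectrum ℂ N, 0 ≤ max (-(z.re - z.im)) 0 := fun _ _ => le_max_right _ _
  have hm0 : ∀ z ∈ spectrum ℂ N, 0 ≤ min z.re z.im := fun z hz => le_min (hp0 z hz) (hq0 z hz)
  have tp : trNorm (realCfc N fun z => z.re) = 1 := by rw [hre]; exact hρ.2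
  have tq : trNorm (realCfc N fun z => z.im) = 1 := by rw [him]; exact hσ.2
  have hsub : ρ - σ = realCfc N fun z => z.re - z.im := by rw [realCfc_sub cp cq, hre, him]
  have tma : trNorm (realCfc N fun z => min z.re z.im)
      + trNorm (realCfc N fun z => max (z.re - z.im) 0) = 1 := by
    rw [← trNorm_realCfc_add cm ca hm0 ha0, ← tp]
    congr 2 with z
    rcases le_total z.re z.im with h | h <;> simp [h]
  have tmb : trNorm (realCfc N fun z => min z.re z.im)
      + trNorm (realCfc N fun z => max (-(z.re - z.im)) 0) = 1 := by
    rw [← trNorm_realCfc_add cm cb hm0 hb0, ← tq]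
    congr 2 with z
    rcases le_total z.re z.im with h | h <;> simp [h]
  have hm_ne : trNorm (realCfc N fun z => min z.re z.im) ≠ ⊤ := fun h => by simp [h] at tma
  have tab : trNorm (realCfc N fun z => max (-(z.re - z.im)) 0)
      = trNorm (realCfc N fun z => max (z.re - z.im) 0) :=
    (ENNReal.add_right_inj hm_ne).1 (tmb.trans tma.symm)
  have h_ab : (fun z : ℂ => max (z.re - z.im) 0 - max (-(z.re - z.im)) 0)
      = fun z => z.re - z.im := by
    ext z
    rcases le_total z.re z.im with h | h <;> simp [h]
  have ta_le : trNorm (realCfc N fun z => max (z.re - z.im) 0) ≤ ENNReal.ofReal ε := by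
    have h := IsPositive.trNorm_add_le_trNorm_sub (isPositive_realCfc ha0)
      (isPositive_realCfc hb0) (by
        rw [← realCfc_mul ca cb, ← realCfc_zero (N := N)]
        congr 1 with z
        rcases le_total z.re z.im with h | h <;> simp [h])
    rw [← realCfc_sub ca cb, tab, ← two_mul] at h
    rw [h_ab, ← hsub, hdist, ENNReal.ofReal_mul zero_le_two, ENNReal.ofReal_ofNat] at h
    exact (ENNReal.mul_le_mul_iff_right two_ne_zero ENNReal.ofNat_ne_top).1 h
  have ta : trNorm (realCfc N fun z => max (z.re - z.im) 0) = ENNReal.ofReal ε := by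
    refine le_antisymm ta_le ?_
    have h := trNorm_sub_le (realCfc N fun z => max (z.re - z.im) 0)
      (realCfc N fun z => max (-(z.re - z.im)) 0)
    rw [← realCfc_sub ca cb, tab, ← two_mul, h_ab, ← hsub, hdist,
      ENNReal.ofReal_mul zero_le_two, ENNReal.ofReal_ofNat] at h
    exact (ENNReal.mul_le_mul_iff_right two_ne_zero ENNReal.ofNat_ne_top).1 h
  have hε1 : ε ≤ 1 := by
    rw [← ENNReal.ofReal_le_one, ← ta, ← tma]
    exact le_add_self
  have tm : trNorm (realCfc N fun z => min z.re z.im) = ENNReal.ofReal (1 - ε) := by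
    rw [ta] at tma
    rw [ENNReal.ofReal_sub _ hε.le, ENNReal.ofReal_one, ← tma,
      ENNReal.add_sub_cancel_right ENNReal.ofReal_ne_top]
  have hp1 := le_of_trNorm_realCfc_le hN cp hp0 zero_le_one (by rw [tp, ENNReal.ofReal_one])
  have hq1 := le_of_trNorm_realCfc_le hN cq hq0 zero_le_one (by rw [tq, ENNReal.ofReal_one])
  have ha1 := le_of_trNorm_realCfc_le hN ca ha0 hε.le ta.le
  have hb1 := le_of_trNorm_realCfc_le hN cb hb0 hε.le (tab.trans ta).le
  have hm1 := le_of_trNorm_realCfc_le hN cm hm0 (sub_nonneg.2 hε1) tm.le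
  have hεi : 0 ≤ ε⁻¹ := inv_nonneg.2 hε.le
  have hηa : ∀ z ∈ spectrum ℂ N, 0 ≤ ε * eta (ε⁻¹ * max (z.re - z.im) 0) := fun z hz =>
    mul_nonneg hε.le (eta_nonneg (mul_nonneg hεi (ha0 z hz))
      (inv_mul_le_one_of_le₀ (ha1 z hz) hε.le))
  have hηb : ∀ z ∈ spectrum ℂ N, 0 ≤ ε * eta (ε⁻¹ * max (-(z.re - z.im)) 0) := fun z hz =>
    mul_nonneg hε.le (eta_nonneg (mul_nonneg hεi (hb0 z hz))
      (inv_mul_le_one_of_le₀ (hb1 z hz) hε.le))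
  have hηp : ∀ z ∈ spectrum ℂ N, 0 ≤ eta z.re := fun z hz => eta_nonneg (hp0 z hz) (hp1 z hz)
  have hηq : ∀ z ∈ spectrum ℂ N, 0 ≤ eta z.im := fun z hz => eta_nonneg (hq0 z hz) (hq1 z hz)
  have hl1 : 0 ≤ -Real.log ε := neg_nonneg.2 (Real.log_nonpos hε.le hε1)
  have hl2 : 0 ≤ -Real.log (1 - ε) := neg_nonneg.2 (Real.log_nonpos (by linarith) (by linarith))
  have cη := continuous_eta
  have eρ : entropy ρ = trNorm (realCfc N fun z => eta z.re) := by
    rw [entropy, ← cfc_realCfc hN cp cη, hre]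
  have eσ : entropy σ = trNorm (realCfc N fun z => eta z.im) := by
    rw [entropy, ← cfc_realCfc hN cq cη, him]
  have epos : ENNReal.ofReal ε * entropy (ε⁻¹ • posP (ρ - σ))
      = trNorm (realCfc N fun z => ε * eta (ε⁻¹ * max (z.re - z.im) 0)) := by
    rw [entropy, posP, hsub, cfc_realCfc hN (by fun_prop) (by fun_prop), ← realCfc_const_mul ca,
      cfc_realCfc hN (by fun_prop) cη, trNorm_realCfc_const_mul (by fun_prop) hε.le]
  have eneg : ENNReal.ofReal ε * entropy (ε⁻¹ • negP (ρ - σ))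
      = trNorm (realCfc N fun z => ε * eta (ε⁻¹ * max (-(z.re - z.im)) 0)) := by
    rw [entropy, negP, hsub, cfc_realCfc hN (by fun_prop) (by fun_prop), ← realCfc_const_mul cb,
      cfc_realCfc hN (by fun_prop) cη, trNorm_realCfc_const_mul (by fun_prop) hε.le]
  have ebin : ENNReal.ofReal (binEnt ε)
      = trNorm (realCfc N fun z => (-Real.log ε) * max (z.re - z.im) 0)
        + trNorm (realCfc N fun z => (-Real.log (1 - ε)) * min z.re z.im) := by
    rw [trNorm_realCfc_const_mul ca hl1, trNorm_realCfc_const_mul cm hl2, ta, tm,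
      ← ENNReal.ofReal_mul hl1, ← ENNReal.ofReal_mul hl2, ← ENNReal.ofReal_add
        (mul_nonneg hl1 hε.le) (mul_nonneg hl2 (sub_nonneg.2 hε1))]
    congr 1
    unfold binEnt eta
    ring
  have hla : ∀ z ∈ spectrum ℂ N, 0 ≤ (-Real.log ε) * max (z.re - z.im) 0 :=
    fun z hz => mul_nonneg hl1 (ha0 z hz)
  have hlm : ∀ z ∈ spectrum ℂ N, 0 ≤ (-Real.log (1 - ε)) * min z.re z.im :=
    fun z hz => mul_nonneg hl2 (hm0 z hz)
  rw [eρ, eσ, epos, eneg, ebin, ← add_assoc,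
    ← trNorm_realCfc_add (by fun_prop) (by fun_prop) hηp hηb,
    ← trNorm_realCfc_add (by fun_prop) (by fun_prop) hηq hηa,
    ← trNorm_realCfc_add (by fun_prop) (by fun_prop)
      (fun z hz => add_nonneg (hηq z hz) (hηa z hz)) hla,
    ← trNorm_realCfc_add (by fun_prop) (by fun_prop)
      (fun z hz => add_nonneg (add_nonneg (hηq z hz) (hηa z hz)) (hla z hz)) hlm]
  exact trNorm_realCfc_mono (by fun_prop) (by fun_prop)
    (fun z hz => add_nonneg (hηp z hz) (hηb z hz))
    fun z hz => eta_add_mul_eta_le (hp0 z hz) (hq0 z hz) hε hε1 (hm1 z hz)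

end AFW
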